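/- Fix c ≥ 0. There exists a Borel measurable function H^c : ℝ^N_{++} × M → ℝ^N, where M is the set of N×N matrices with nonnegative entries and zero diagonal, such that for every (a, ℓ) ∈ ℝ^N_{++} × M: H^c(a, ℓ) ≥ 0 componentwise, Σ_{i=1}^N H^c(a, ℓ)_i = c, and Λ(a + H^c(a, ℓ), ℓ) ≤ Λ(a + y, ℓ) for every y ∈ ℝ^N with y ≥ 0 and Σ_i y_i = c. In other words, H^c is a measurable selection of pointwise optimal bailout allocations at capital level c. -/

import Mathlib

/-- Total liability vector: `ℓ̄_i = ∑_j ℓ_{ij}`. -/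
noncomputable def lbar {N : ℕ} (ℓ : Fin N → Fin N → ℝ) : Fin N → ℝ := fun i => ∑ j, ℓ i j

/-- Relative liability matrix: `π_{ij} = ℓ_{ij}/ℓ̄_i` if `ℓ̄_i > 0`, else `0`. -/
noncomputable def relPi {N : ℕ} (ℓ : Fin N → Fin N → ℝ) : Fin N → Fin N → ℝ :=
  fun i j => if 0 < lbar ℓ i then ℓ i j / lbar ℓ i else 0

/-- The Eisenberg–Noe clearing map `Φ(p, a, π, ℓ̄) = (πᵀp + a) ∧ ℓ̄`. -/
noncomputable def Phi {N : ℕ} (π : Fin N → Fin N → ℝ) (a lb p : Fin N → ℝ) : Fin N → ℝ :=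
  fun i => min ((∑ j, π j i * p j) + a i) (lb i)

/-- The clearing vector `CV(a, ℓ)`: the (for `a ∈ ℝ^N_{++}` unique) nonnegative fixed
point of the clearing map associated with the liability matrix `ℓ`. -/
noncomputable def clearingVec {N : ℕ} (a : Fin N → ℝ) (ℓ : Fin N → Fin N → ℝ) : Fin N → ℝ :=
  Classical.epsilon fun p => (∀ i, 0 ≤ p i) ∧ Phi (relPi ℓ) a (lbar ℓ) p = p

/-- The Eisenberg–Noe aggregation function `Λ(a, ℓ) = ∑_i (ℓ̄_i − CV_i(a, ℓ))`. -/
noncomputable def aggLoss {N : ℕ} (a : Fin N → ℝ) (ℓ : Fin N → Fin N → ℝ) : ℝ :=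
  ∑ i, (lbar ℓ i - clearingVec a ℓ i)

open Set Filter Topology

section MeasurableArgmin

variable {X E : Type*} [MeasurableSpace X] [TopologicalSpace E] [SecondCountableTopology E]

/-- The minimum over a compact set of a Carathéodory function is measurable. -/
theorem exists_measurable_isLeast_image {f : X → E → ℝ} {K : Set E} (hK : IsCompact K)
    (hne : K.Nonempty) (hm : ∀ y ∈ K, Measurable fun x => f x y)
    (hf : ∀ x, ContinuousOn (f x) K) :
    ∃ m : X → ℝ, Measurable m ∧ ∀ x, IsLeast (f x '' K) (m x) := by
  have hleast : ∀ x, IsLeast (f x '' K) (sInf (f x '' K)) := fun x =>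
    (hK.image_of_continuousOn (hf x)).isLeast_sInf (hne.image _)
  refine ⟨fun x => sInf (f x '' K), measurable_of_Iio fun t => ?_, hleast⟩
  have : Nonempty K := hne.to_subtype
  have key : (fun x => sInf (f x '' K)) ⁻¹' Iio t
      = ⋃ n, {x | f x (TopologicalSpace.denseSeq K n) < t} := by
    ext x
    simp only [mem_preimage, mem_Iio, mem_iUnion, mem_ofPred_eq]
    constructor
    · intro hx
      obtain ⟨y, hy, hyx⟩ := (hleast x).1
      have hopen : IsOpen {z : K | f x z < t} :=
        isOpen_lt (continuousOn_iff_continuous_domRestrict.1 (hf x)) continuous_const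
      obtain ⟨z, hz, n, rfl⟩ :=
        (TopologicalSpace.denseRange_denseSeq K).inter_open_nonempty _ hopen
          ⟨⟨y, hy⟩, hyx.trans_lt hx⟩
      exact ⟨n, hz⟩
    · rintro ⟨n, hn⟩
      exact ((hleast x).2 (mem_image_of_mem _ (TopologicalSpace.denseSeq K n).2)).trans_lt hn
  rw [key]
  exact MeasurableSet.iUnion fun n =>
    measurableSet_lt (hm _ (TopologicalSpace.denseSeq K n).2) measurable_const

/-- The smallest value of a continuous function on the set of minimizers of a Carathéodory
function is measurable. -/
theorem exists_measurable_value_on_argmin {f : X → E → ℝ} {K : Set E} (hK : IsCompact K)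
    (hne : K.Nonempty) (hm : ∀ y ∈ K, Measurable fun x => f x y)
    (hf : ∀ x, ContinuousOn (f x) K) {g : E → ℝ} (hg : Continuous g) :
    ∃ v : X → ℝ, Measurable v ∧ ∀ x, ∃ y ∈ K, IsMinOn (f x) K y ∧ g y = v x := by
  obtain ⟨m, hmm, hleast⟩ := exists_measurable_isLeast_image hK hne hm hf
  set A : X → Set E := fun x => {y ∈ K | f x y ≤ m x}
  have hAc : ∀ x, IsCompact (A x) := by
    intro x
    have := (hf x).lowerSemicontinuousOn.isCompact_inter_preimage_Iic hK (m x)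
    exact this
  have hAne : ∀ x, (A x).Nonempty := fun x =>
    let ⟨y, hy, hyx⟩ := (hleast x).1
    ⟨y, hy, hyx.le⟩
  have hv : ∀ x, IsLeast (g '' A x) (sInf (g '' A x)) := fun x =>
    ((hAc x).image hg).isLeast_sInf ((hAne x).image _)
  refine ⟨fun x => sInf (g '' A x), measurable_of_Iic fun t => ?_, fun x => ?_⟩
  · have key : (fun x => sInf (g '' A x)) ⁻¹' Iic t
        = {x | ∃ y ∈ K ∩ g ⁻¹' Iic t, f x y ≤ m x} := by
      ext x
      simp only [mem_preimage, mem_Iic, mem_ofPred_eq]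
      constructor
      · intro hx
        obtain ⟨y, hy, hyx⟩ := (hv x).1
        exact ⟨y, ⟨hy.1, hyx.trans_le hx⟩, hy.2⟩
      · rintro ⟨y, ⟨hyK, hyt⟩, hy⟩
        exact ((hv x).2 (mem_image_of_mem _ ⟨hyK, hy⟩)).trans hyt
    rw [key]
    rcases (K ∩ g ⁻¹' Iic t).eq_empty_or_nonempty with h | h
    · simp [h]
    obtain ⟨m', hm', hleast'⟩ := exists_measurable_isLeast_image
      (hK.inter_right (isClosed_Iic.preimage hg)) h (fun y hy => hm y hy.1)
      (fun x => (hf x).mono inter_subset_left)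
    convert measurableSet_le hm' hmm using 1
    ext x
    constructor
    · rintro ⟨y, hy, hyx⟩
      exact ((hleast' x).2 (mem_image_of_mem _ hy)).trans hyx
    · intro hx
      obtain ⟨y, hy, hyx⟩ := (hleast' x).1
      exact ⟨y, hy, hyx.trans_le hx⟩
  · obtain ⟨y, hy, hyx⟩ := (hv x).1
    exact ⟨y, hy.1, fun z hz => hy.2.trans ((hleast x).2 (mem_image_of_mem _ hz)), hyx⟩

/-- A Carathéodory function on a compact subset of a finite-dimensional space has a measurable
selection of minimizers. -/
theorem exists_measurable_isMinOn {ι : Type*} [Finite ι] {f : X → (ι → ℝ) → ℝ}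
    {K : Set (ι → ℝ)} (hK : IsCompact K) (hne : K.Nonempty)
    (hm : ∀ y ∈ K, Measurable fun x => f x y) (hf : ∀ x, ContinuousOn (f x) K) :
    ∃ H : X → ι → ℝ, Measurable H ∧ ∀ x, H x ∈ K ∧ IsMinOn (f x) K (H x) := by
  classical
  have := Fintype.ofFinite ι
  obtain ⟨m, hmm, hleast⟩ := exists_measurable_isLeast_image hK hne hm hf
  have key : ∀ s : Finset ι, ∃ H : X → ι → ℝ, Measurable H ∧
      ∀ x, ∃ y ∈ K, IsMinOn (f x) K y ∧ ∀ i ∈ s, y i = H x i := by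
    intro s
    induction s using Finset.induction_on with
    | empty =>
      refine ⟨fun _ _ => 0, measurable_const, fun x => ?_⟩
      obtain ⟨y, hy, hmin⟩ := hK.exists_isMinOn hne (hf x)
      exact ⟨y, hy, hmin, by simp⟩
    | insert i s his ih =>
      obtain ⟨H, hH, hsel⟩ := ih
      have hHi : ∀ j, Measurable fun x => H x j := fun j => (measurable_pi_apply j).comp hH
      obtain ⟨v, hvm, hv⟩ := exists_measurable_value_on_argmin
        (f := fun x y => (f x y - m x) + ∑ j ∈ s, |y j - H x j|) hK hne
        (fun y hy => ((hm y hy).sub hmm).add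
          (Finset.measurable_fun_sum _ fun j _ => (measurable_const.sub (hHi j)).abs))
        (fun x => ((hf x).sub continuousOn_const).add
          (Continuous.continuousOn (by fun_prop))) (continuous_apply i)
      refine ⟨fun x => Function.update (H x) i (v x), ?_, fun x => ?_⟩
      · refine measurable_pi_lambda _ fun j => ?_
        rcases eq_or_ne j i with rfl | hj
        · simpa using hvm
        · simpa [hj] using hHi j
      · obtain ⟨y, hy, hmin, hyv⟩ := hv x
        obtain ⟨z, hz, hzmin, hzs⟩ := hsel x
        obtain ⟨w, hw, hwx⟩ := (hleast x).1
        have hle := hmin hz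
        have h0 : ∑ j ∈ s, |z j - H x j| = 0 :=
          Finset.sum_eq_zero fun j hj => by simp [hzs j hj]
        have h1 := hzmin hw
        have h2 := (hleast x).2 (mem_image_of_mem _ hy)
        have h3 : 0 ≤ ∑ j ∈ s, |y j - H x j| := Finset.sum_nonneg fun j _ => abs_nonneg _
        simp only [mem_ofPred_eq] at hle h1
        have h4 : ∑ j ∈ s, |y j - H x j| = 0 := by linarith
        refine ⟨y, hy, fun u hu => ?_, fun j hj => ?_⟩
        · have h5 := (hleast x).2 (mem_image_of_mem _ hu)
          simp only [mem_ofPred_eq]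
          linarith
        · rcases eq_or_ne j i with rfl | hji
          · simpa using hyv
          · have h6 := (Finset.sum_eq_zero_iff_of_nonneg fun j _ => abs_nonneg _).1 h4 j
              (Finset.mem_of_mem_insert_of_ne hj hji)
            simpa [hji, sub_eq_zero] using h6
  obtain ⟨H, hH, hsel⟩ := key Finset.univ
  refine ⟨H, hH, fun x => ?_⟩
  obtain ⟨y, hy, hmin, hyH⟩ := hsel x
  obtain rfl : y = H x := funext fun i => hyH i (Finset.mem_univ i)
  exact ⟨hy, hmin⟩

end MeasurableArgmin

section ClearingVector

variable {N : ℕ}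

theorem lbar_nonneg {ℓ : Fin N → Fin N → ℝ} (hℓ : ∀ i j, 0 ≤ ℓ i j) (i : Fin N) :
    0 ≤ lbar ℓ i :=
  Finset.sum_nonneg fun j _ => hℓ i j

theorem continuous_lbar (i : Fin N) : Continuous fun ℓ : Fin N → Fin N → ℝ => lbar ℓ i := by
  unfold lbar
  fun_prop

theorem relPi_nonneg {ℓ : Fin N → Fin N → ℝ} (hℓ : ∀ i j, 0 ≤ ℓ i j) (i j : Fin N) :
    0 ≤ relPi ℓ i j := by
  unfold relPi
  split_ifs with h
  · exact div_nonneg (hℓ i j) h.le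
  · exact le_rfl

theorem relPi_le_one {ℓ : Fin N → Fin N → ℝ} (hℓ : ∀ i j, 0 ≤ ℓ i j) (i j : Fin N) :
    relPi ℓ i j ≤ 1 := by
  unfold relPi
  split_ifs with h
  · exact div_le_one_of_le₀
      (Finset.single_le_sum (f := ℓ i) (fun k _ => hℓ i k) (Finset.mem_univ j)) h.le
  · exact zero_le_one

theorem Phi_mono {π : Fin N → Fin N → ℝ} (hπ : ∀ i j, 0 ≤ π i j) (a lb : Fin N → ℝ) :
    Monotone (Phi π a lb) := fun _ _ hpq i =>
  min_le_min_right _ <| add_le_add_left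
    (Finset.sum_le_sum fun j _ => mul_le_mul_of_nonneg_left (hpq j) (hπ j i)) _

theorem continuous_Phi (π : Fin N → Fin N → ℝ) (a lb : Fin N → ℝ) :
    Continuous (Phi π a lb) := by
  unfold Phi
  fun_prop

/-- The clearing map has a nonnegative fixed point. -/
theorem exists_Phi_fixedPoint {π : Fin N → Fin N → ℝ} {a lb : Fin N → ℝ}
    (hπ : ∀ i j, 0 ≤ π i j) (ha : ∀ i, 0 ≤ a i) (hlb : ∀ i, 0 ≤ lb i) :
    ∃ p, (∀ i, 0 ≤ p i) ∧ Phi π a lb p = p := by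
  have hmono : Monotone fun n => (Phi π a lb)^[n] 0 :=
    (Phi_mono hπ a lb).monotone_iterate_of_le_map fun i => by
      simpa [Phi] using And.intro (ha i) (hlb i)
  have hbdd : ∀ n i, (Phi π a lb)^[n] 0 i ≤ lb i := by
    intro n i
    cases n with
    | zero => exact hlb i
    | succ n =>
      rw [Function.iterate_succ_apply']
      exact min_le_right _ _
  have hlim : Tendsto (fun n => (Phi π a lb)^[n] 0) atTop
      (𝓝 fun i => ⨆ n, (Phi π a lb)^[n] 0 i) :=
    tendsto_pi_nhds.2 fun i => tendsto_atTop_ciSup (fun _ _ h => hmono h i)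
      ⟨lb i, forall_mem_range.2 fun n => hbdd n i⟩
  refine ⟨_, fun i => ge_of_tendsto' (tendsto_pi_nhds.1 hlim i) fun n =>
    hmono (Nat.zero_le n) i, ?_⟩
  exact isFixedPt_of_tendsto_iterate hlim (continuous_Phi π a lb).continuousAt

theorem Phi_fixedPoint_le {π : Fin N → Fin N → ℝ} {a lb p q : Fin N → ℝ}
    (hπ : ∀ i j, 0 ≤ π i j) (ha : ∀ i, 0 < a i) (hp0 : ∀ i, 0 ≤ p i)
    (hp : Phi π a lb p = p) (hq0 : ∀ i, 0 ≤ q i) (hq : Phi π a lb q = q) : q ≤ p := by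
  intro k
  by_contra! hk
  obtain ⟨i, hi, hmin⟩ := (Finset.univ.filter fun i => 0 < q i).exists_min_image
    (fun i => p i / q i) ⟨k, by simpa using (hp0 k).trans_lt hk⟩
  have hqi : 0 < q i := by simpa using hi
  set t := p i / q i with ht
  have hpi : p i = t * q i := by rw [ht, div_mul_cancel₀ _ hqi.ne']
  have ht0 : 0 ≤ t := div_nonneg (hp0 i) hqi.le
  have ht1 : t < 1 := by
    have hqk := (hp0 k).trans_lt hk
    exact (hmin k (by simpa using hqk)).trans_lt ((div_lt_one hqk).2 hk)
  have hle : ∀ j, t * q j ≤ p j := by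
    intro j
    rcases (hq0 j).eq_or_lt with h | h
    · simpa [← h] using hp0 j
    · exact (le_div_iff₀ h).1 (hmin j (by simpa using h))
  have hsum : t * ∑ j, π j i * q j ≤ ∑ j, π j i * p j := by
    rw [Finset.mul_sum]
    refine Finset.sum_le_sum fun j _ => ?_
    nlinarith [mul_le_mul_of_nonneg_left (hle j) (hπ j i)]
  have hqle1 : q i ≤ (∑ j, π j i * q j) + a i := (congrFun hq i).ge.trans (min_le_left _ _)
  have hqle2 : q i ≤ lb i := (congrFun hq i).ge.trans (min_le_right _ _)
  have hlt : p i < Phi π a lb p i := by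
    refine lt_min ?_ ?_
    · nlinarith [mul_le_mul_of_nonneg_left hqle1 ht0, mul_lt_mul_of_pos_right ht1 (ha i)]
    · nlinarith [mul_lt_mul_of_pos_right ht1 hqi]
  exact hlt.ne (congrFun hp i).symm

theorem clearingVec_spec {a : Fin N → ℝ} {ℓ : Fin N → Fin N → ℝ} (ha : ∀ i, 0 < a i)
    (hℓ : ∀ i j, 0 ≤ ℓ i j) :
    (∀ i, 0 ≤ clearingVec a ℓ i) ∧
      Phi (relPi ℓ) a (lbar ℓ) (clearingVec a ℓ) = clearingVec a ℓ :=
  Classical.epsilon_spec (exists_Phi_fixedPoint (relPi_nonneg hℓ) (fun i => (ha i).le)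
    (lbar_nonneg hℓ))

theorem clearingVec_le_lbar {a : Fin N → ℝ} {ℓ : Fin N → Fin N → ℝ} (ha : ∀ i, 0 < a i)
    (hℓ : ∀ i j, 0 ≤ ℓ i j) (i : Fin N) : clearingVec a ℓ i ≤ lbar ℓ i :=
  (congrFun (clearingVec_spec ha hℓ).2 i).ge.trans (min_le_right _ _)

theorem eq_clearingVec {a p : Fin N → ℝ} {ℓ : Fin N → Fin N → ℝ} (ha : ∀ i, 0 < a i)
    (hℓ : ∀ i j, 0 ≤ ℓ i j) (hp0 : ∀ i, 0 ≤ p i) (hp : Phi (relPi ℓ) a (lbar ℓ) p = p) :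
    p = clearingVec a ℓ :=
  have h := clearingVec_spec ha hℓ
  le_antisymm (Phi_fixedPoint_le (relPi_nonneg hℓ) ha h.1 h.2 hp0 hp)
    (Phi_fixedPoint_le (relPi_nonneg hℓ) ha hp0 hp h.1 h.2)

/-- Financial networks: positive endowments and nonnegative liabilities. -/
def networks (N : ℕ) : Set ((Fin N → ℝ) × (Fin N → Fin N → ℝ)) :=
  {x | (∀ i, 0 < x.1 i) ∧ ∀ i j, 0 ≤ x.2 i j}

theorem measurableSet_networks (N : ℕ) : MeasurableSet (networks N) := by
  unfold networks
  measurability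

/-- The clearing vector depends continuously on the network. The relative liabilities are not
continuous where a total liability vanishes, but there the payments vanish as well. -/
theorem continuousOn_clearingVec :
    ContinuousOn (fun x : (Fin N → ℝ) × (Fin N → Fin N → ℝ) => clearingVec x.1 x.2)
      (networks N) := by
  intro x₀ hx₀
  have hlbar : ∀ i, Tendsto (fun x : (Fin N → ℝ) × (Fin N → Fin N → ℝ) => lbar x.2 i) (𝓝 x₀)
      (𝓝 (lbar x₀.2 i)) := fun i => ((continuous_lbar i).comp continuous_snd).tendsto x₀
  have hself : ∀ᶠ x in 𝓝[networks N] x₀, x ∈ networks N := self_mem_nhdsWithin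
  have hbdd : ∀ᶠ x in 𝓝[networks N] x₀,
      clearingVec x.1 x.2 ∈ Icc (0 : Fin N → ℝ) fun i => lbar x₀.2 i + 1 := by
    have hlt : ∀ᶠ x in 𝓝[networks N] x₀, ∀ i, lbar x.2 i < lbar x₀.2 i + 1 :=
      eventually_all.2 fun i => nhdsWithin_le_nhds
        ((hlbar i).eventually_lt_const (lt_add_one _))
    filter_upwards [hself, hlt] with x hx hxlt
    exact ⟨(clearingVec_spec hx.1 hx.2).1, fun i =>
      (clearingVec_le_lbar hx.1 hx.2 i).trans (hxlt i).le⟩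
  refine isCompact_Icc.tendsto_nhds_of_unique_mapClusterPt hbdd fun y hy hcl => ?_
  obtain ⟨U, hU, hUy⟩ := mapClusterPt_iff_ultrafilter.1 hcl
  have hU' : (U : Filter _) ≤ 𝓝 x₀ := hU.trans nhdsWithin_le_nhds
  have hUself := hself.filter_mono hU
  have hUyi := tendsto_pi_nhds.1 hUy
  have hterm : ∀ i j, Tendsto (fun x : (Fin N → ℝ) × (Fin N → Fin N → ℝ) =>
      relPi x.2 j i * clearingVec x.1 x.2 j) U (𝓝 (relPi x₀.2 j i * y j)) := by
    intro i j
    refine (lbar_nonneg hx₀.2 j).eq_or_lt.elim (fun h => ?_) fun h => ?_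
    · have hπ : relPi x₀.2 j i = 0 := by simp [relPi, ← h]
      have hl := (hlbar j).mono_left hU'
      rw [← h] at hl
      rw [hπ, zero_mul]
      refine squeeze_zero' ?_ ?_ hl
      · filter_upwards [hUself] with x hx
        exact mul_nonneg (relPi_nonneg hx.2 j i) ((clearingVec_spec hx.1 hx.2).1 j)
      · filter_upwards [hUself] with x hx
        exact (mul_le_of_le_one_left ((clearingVec_spec hx.1 hx.2).1 j)
          (relPi_le_one hx.2 j i)).trans (clearingVec_le_lbar hx.1 hx.2 j)
    · refine Tendsto.mul ?_ (hUyi j)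
      have hℓ : Tendsto (fun x : (Fin N → ℝ) × (Fin N → Fin N → ℝ) => x.2 j i) (𝓝 x₀)
          (𝓝 (x₀.2 j i)) := Continuous.tendsto (by fun_prop) x₀
      have hdiv := (hℓ.div (hlbar j) h.ne').mono_left hU'
      simp only [relPi, if_pos h]
      refine hdiv.congr' ?_
      filter_upwards [((hlbar j).mono_left hU').eventually_const_lt h] with x hx
      simp [hx]
  refine eq_clearingVec hx₀.1 hx₀.2 hy.1 (funext fun i => ?_)
  have ha : Tendsto (fun x : (Fin N → ℝ) × (Fin N → Fin N → ℝ) => x.1 i) U (𝓝 (x₀.1 i)) :=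
    (Continuous.tendsto (by fun_prop) x₀).mono_left hU'
  have hPhi : Tendsto (fun x : (Fin N → ℝ) × (Fin N → Fin N → ℝ) =>
      Phi (relPi x.2) x.1 (lbar x.2) (clearingVec x.1 x.2) i) U
      (𝓝 (Phi (relPi x₀.2) x₀.1 (lbar x₀.2) y i)) := by
    unfold Phi
    exact ((tendsto_finsetSum _ fun j _ => hterm i j).add ha).min ((hlbar i).mono_left hU')
  refine tendsto_nhds_unique (hPhi.congr' ?_) (hUyi i)
  filter_upwards [hUself] with x hx
  exact congrFun (clearingVec_spec hx.1 hx.2).2 i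

theorem continuousOn_aggLoss :
    ContinuousOn (fun x : (Fin N → ℝ) × (Fin N → Fin N → ℝ) => aggLoss x.1 x.2)
      (networks N) :=
  continuousOn_finsetSum _ fun i _ =>
    ((continuous_lbar i).comp continuous_snd).continuousOn.sub
      (continuousOn_pi.1 continuousOn_clearingVec i)

end ClearingVector

/-- For each capital level `c ≥ 0` there is a Borel measurable function
`H^c : ℝ^N_{++} × M → ℝ^N` selecting, for every financial network `(a, ℓ)`, a pointwise
optimal bailout allocation of the capital `c`. -/
theorem exists_measurable_optimal_allocation
    (N : ℕ) (hN : 1 ≤ N) (c : ℝ) (hc : 0 ≤ c) :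
    ∃ H : (Fin N → ℝ) → (Fin N → Fin N → ℝ) → (Fin N → ℝ),
      Measurable (fun x : (Fin N → ℝ) × (Fin N → Fin N → ℝ) => H x.1 x.2) ∧
      ∀ (a : Fin N → ℝ) (ℓ : Fin N → Fin N → ℝ),
        (∀ i, 0 < a i) → (∀ i j, 0 ≤ ℓ i j) → (∀ i, ℓ i i = 0) →
        (∀ i, 0 ≤ H a ℓ i) ∧ (∑ i, H a ℓ i) = c ∧
        ∀ y : Fin N → ℝ, (∀ i, 0 ≤ y i) → (∑ i, y i) = c →
          aggLoss (fun i => a i + H a ℓ i) ℓ ≤ aggLoss (fun i => a i + y i) ℓ := by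
  classical
  have : NeZero N := ⟨by omega⟩
  set K : Set (Fin N → ℝ) := {y | (∀ i, 0 ≤ y i) ∧ ∑ i, y i = c} with hKdef
  have hK : IsCompact K := by
    refine (isCompact_Icc (a := (0 : Fin N → ℝ)) (b := fun _ => c)).of_isClosed_subset ?_ ?_
    · simp only [hKdef, ofPred_and, ofPred_forall]
      exact (isClosed_iInter fun i => isClosed_le continuous_const (continuous_apply i)).inter
        (isClosed_eq (by fun_prop) continuous_const)
    · rintro y ⟨hy0, hyc⟩
      exact ⟨hy0, fun i => hyc ▸ Finset.single_le_sum (fun j _ => hy0 j) (Finset.mem_univ i)⟩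
  have hne : K.Nonempty :=
    ⟨Pi.single 0 c, fun i => (Pi.single_nonneg.2 hc : (0 : Fin N → ℝ) ≤ Pi.single 0 c) i,
      by simp⟩
  have hadd : ∀ x ∈ networks N, ∀ y ∈ K, (x.1 + y, x.2) ∈ networks N := fun x hx y hy =>
    ⟨fun i => add_pos_of_pos_of_nonneg (hx.1 i) (hy.1 i), hx.2⟩
  set f : (Fin N → ℝ) × (Fin N → Fin N → ℝ) → (Fin N → ℝ) → ℝ := fun x y =>
    (networks N).piecewise (fun x => aggLoss (x.1 + y) x.2) 0 x
  have hf_mem : ∀ x ∈ networks N, f x = fun y => aggLoss (x.1 + y) x.2 := fun x hx =>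
    funext fun y => piecewise_eq_of_mem _ _ _ hx
  have hf_notMem : ∀ x ∉ networks N, f x = fun _ => 0 := fun x hx =>
    funext fun y => piecewise_eq_of_notMem _ _ _ hx
  have hfm : ∀ y ∈ K, Measurable fun x => f x y := fun y hy => by
    have hcont : ContinuousOn
        (fun x : (Fin N → ℝ) × (Fin N → Fin N → ℝ) => aggLoss (x.1 + y) x.2) (networks N) :=
      continuousOn_aggLoss.comp
        (f := fun x : (Fin N → ℝ) × (Fin N → Fin N → ℝ) => (x.1 + y, x.2))
        (Continuous.continuousOn (by fun_prop)) fun x hx => hadd x hx y hy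
    exact hcont.measurable_piecewise continuousOn_const (measurableSet_networks N)
  have hfc : ∀ x, ContinuousOn (f x) K := fun x => by
    by_cases hx : x ∈ networks N
    · rw [hf_mem x hx]
      exact continuousOn_aggLoss.comp (f := fun y => (x.1 + y, x.2))
        (Continuous.continuousOn (by fun_prop)) fun y hy => hadd x hx y hy
    · rw [hf_notMem x hx]
      exact continuousOn_const
  obtain ⟨H, hH, hsel⟩ := exists_measurable_isMinOn hK hne hfm hfc
  refine ⟨fun a ℓ => H (a, ℓ), hH, fun a ℓ ha hℓ _ => ?_⟩
  obtain ⟨hHK, hmin⟩ := hsel (a, ℓ)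
  refine ⟨hHK.1, hHK.2, fun y hy0 hyc => ?_⟩
  rw [hf_mem (a, ℓ) ⟨ha, hℓ⟩] at hmin
  exact hmin (show y ∈ K from ⟨hy0, hyc⟩)
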